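/- arXiv:math/9809130 — 2 statements merged into one kernel-verified Lean document; each statement's English description precedes it below -/
import Mathlib

section
/- Let V be a finite-dimensional real vector space. The linear map Φ : Λ V ⊗ Λ V* → End(Λ V) determined by Φ(ω ⊗ η) = m(ω) ∘ c(η) is a linear isomorphism. (This is the algebraic content of the paper's theorem that, for the fermionic quantization at a point, the quantization map f ↦ f̂ and the symbol map A ↦ σA are mutually inverse: every endomorphism of the exterior algebra is the quantization of a unique symbol in Λ V ⊗ Λ V*.) -/
noncomputable section

open ExteriorAlgebra

variable (V : Type*) [AddCommGroup V] [Module ℝ V]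

/-- Left exterior multiplication `m(ω) = ω ∧ ·`, as a linear map
`Λ V →ₗ End(Λ V)`. -/
def extMul : ExteriorAlgebra ℝ V →ₗ[ℝ] Module.End ℝ (ExteriorAlgebra ℝ V) :=
  LinearMap.mul ℝ (ExteriorAlgebra ℝ V)

/-- Interior product (left contraction) by a covector `f ∈ V*`, as an
endomorphism of `Λ V`. -/
def interiorProd : Module.Dual ℝ V →ₗ[ℝ] Module.End ℝ (ExteriorAlgebra ℝ V) :=
  CliffordAlgebra.contractLeft

lemma interior_sq_zero (f : Module.Dual ℝ V) :
    interiorProd V f * interiorProd V f = 0 :=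
  LinearMap.ext fun x => CliffordAlgebra.contractLeft_contractLeft f x

/-- The unique algebra homomorphism `c : Λ V* → End(Λ V)` with `c(f) = ι_f`
for every `f ∈ V*`. -/
def contr : ExteriorAlgebra ℝ (Module.Dual ℝ V) →ₐ[ℝ] Module.End ℝ (ExteriorAlgebra ℝ V) :=
  ExteriorAlgebra.lift ℝ ⟨interiorProd V, interior_sq_zero V⟩

/-- The fermionic (normal-ordered) quantization map at a point:
`Φ(ω ⊗ η) = m(ω) ∘ c(η)`. -/
def fermionicQuant :
    TensorProduct ℝ (ExteriorAlgebra ℝ V) (ExteriorAlgebra ℝ (Module.Dual ℝ V)) →ₗ[ℝ]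
      Module.End ℝ (ExteriorAlgebra ℝ V) :=
  TensorProduct.lift
    (((LinearMap.mul ℝ (Module.End ℝ (ExteriorAlgebra ℝ V))).compl₂
        (contr V).toLinearMap).comp (extMul V))

lemma contr_ι_apply (f : Module.Dual ℝ V) (x : ExteriorAlgebra ℝ V) :
    contr V (ExteriorAlgebra.ι ℝ f) x = interiorProd V f x := by
  simp [contr]

lemma interior_comm (f g : Module.Dual ℝ V) (x : ExteriorAlgebra ℝ V) :
    interiorProd V f (interiorProd V g x) = -interiorProd V g (interiorProd V f x) :=
  CliffordAlgebra.contractLeft_comm f g x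

lemma interior_ι_mul (f : Module.Dual ℝ V) (v : V) (x : ExteriorAlgebra ℝ V) :
    interiorProd V f (ExteriorAlgebra.ι ℝ v * x) =
      f v • x - ExteriorAlgebra.ι ℝ v * interiorProd V f x :=
  CliffordAlgebra.contractLeft_ι_mul f v x

lemma interior_one (f : Module.Dual ℝ V) : interiorProd V f 1 = 0 :=
  CliffordAlgebra.contractLeft_one _ f

/-- A contraction that kills `x` also kills every iterated contraction of `x`. -/
lemma interior_contr_list {I : Type*} (d : I → Module.Dual ℝ V) (f : Module.Dual ℝ V)
    (x : ExteriorAlgebra ℝ V) (hx : interiorProd V f x = 0) (l : List I) :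
    interiorProd V f (contr V (l.map fun i => ExteriorAlgebra.ι ℝ (d i)).prod x) = 0 := by
  induction l with
  | nil => simpa using hx
  | cons a l ih =>
    rw [List.map_cons, List.prod_cons, map_mul, Module.End.mul_apply, contr_ι_apply,
      interior_comm, ih]
    simp

lemma contr_list_eq_zero {I : Type*} (d : I → Module.Dual ℝ V) (k : I)
    (x : ExteriorAlgebra ℝ V) (hx : interiorProd V (d k) x = 0) (l : List I) (hk : k ∈ l) :
    contr V (l.map fun i => ExteriorAlgebra.ι ℝ (d i)).prod x = 0 := by
  induction l with
  | nil => simp at hk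
  | cons a l ih =>
    rw [List.map_cons, List.prod_cons, map_mul, Module.End.mul_apply, contr_ι_apply]
    rcases List.mem_cons.1 hk with rfl | h
    · exact interior_contr_list V d _ x hx l
    · rw [ih h, map_zero]

lemma interior_list_eq_zero {I : Type*} (e : I → V) (f : Module.Dual ℝ V) (l : List I)
    (h : ∀ i ∈ l, f (e i) = 0) :
    interiorProd V f (l.map fun i => ExteriorAlgebra.ι ℝ (e i)).prod = 0 := by
  induction l with
  | nil => simpa using interior_one V f
  | cons a l ih =>
    rw [List.map_cons, List.prod_cons, interior_ι_mul, h a (by simp),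
      ih fun i hi => h i (by simp [hi])]
    simp

lemma contr_list_reverse {I : Type*} (e : I → V) (d : I → Module.Dual ℝ V)
    (h1 : ∀ i, d i (e i) = 1) (h0 : ∀ i j, i ≠ j → d i (e j) = 0) (l : List I) (hl : l.Nodup) :
    contr V (l.reverse.map fun i => ExteriorAlgebra.ι ℝ (d i)).prod
      (l.map fun i => ExteriorAlgebra.ι ℝ (e i)).prod = 1 := by
  induction l with
  | nil => simp
  | cons a l ih =>
    obtain ⟨ha, hl⟩ := List.nodup_cons.1 hl
    rw [List.reverse_cons, List.map_append, List.prod_append, map_mul, Module.End.mul_apply,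
      List.map_singleton, List.prod_singleton, contr_ι_apply, List.map_cons, List.prod_cons,
      interior_ι_mul, h1, interior_list_eq_zero V e (d a) l
        (fun i hi => h0 a i (fun h => ha (h ▸ hi)))]
    simpa using ih hl

lemma basis_exists_list {W I : Type*} [AddCommGroup W] [Module ℝ W] [LinearOrder I]
    (b : Module.Basis I ℝ W) (K : Finset I) :
    ∃ l : List I, l.Nodup ∧ (∀ i, i ∈ l ↔ i ∈ K) ∧
      b.ExteriorAlgebra K = (l.map fun i => ExteriorAlgebra.ι ℝ (b i)).prod := by
  refine ⟨List.ofFn (K.orderEmbOfFin rfl), ?_, ?_, ?_⟩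
  · exact List.nodup_ofFn.2 (K.orderEmbOfFin rfl).injective
  · intro i
    rw [List.mem_ofFn, ← Set.mem_range, Finset.range_orderEmbOfFin, Finset.mem_coe]
  · rw [ExteriorAlgebra.basis_apply_ofCard b (rfl : K.card = K.card), List.map_ofFn]
    rfl

lemma fermionicQuant_injective {I : Type*} [LinearOrder I] [Finite I]
    (b : Module.Basis I ℝ V) : Function.Injective (fermionicQuant V) := by
  classical
  rw [← LinearMap.ker_eq_bot, LinearMap.ker_eq_bot']
  intro t ht
  set B := b.dualBasis.ExteriorAlgebra with hB
  obtain ⟨w, rfl⟩ := (TensorProduct.equivFinsuppOfBasisRight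
    (M := ExteriorAlgebra ℝ V) B).symm.surjective t
  suffices h : w = 0 by rw [h, map_zero]
  have key : ∀ x, (w.sum fun K m => m * contr V (B K) x) = 0 := by
    intro x
    have := congrArg (fun T => T x) ht
    simpa [Finsupp.sum, fermionicQuant, extMul] using this
  have h1 : ∀ i, b.dualBasis i (b i) = 1 := fun i => by simp
  have h0 : ∀ i j, i ≠ j → b.dualBasis i (b j) = 0 := fun i j h => by
    simp [h.symm]
  ext1 J
  induction J using Finset.strongInduction with
  | H J ih =>
    obtain ⟨l, hl, hmem, hprod⟩ := basis_exists_list b.dualBasis J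
    have hk := key (l.reverse.map fun i => ExteriorAlgebra.ι ℝ (b i)).prod
    rw [Finsupp.sum, Finset.sum_eq_single J] at hk
    · have := contr_list_reverse V b b.dualBasis h1 h0 l.reverse (List.nodup_reverse.2 hl)
      rw [List.reverse_reverse, ← hprod] at this
      rw [hB, this, mul_one] at hk
      simpa using hk
    · intro K _ hKJ
      by_cases hs : K ⊆ J
      · rw [ih K (Finset.ssubset_iff_subset_ne.2 ⟨hs, hKJ⟩)]
        simp
      · obtain ⟨k, hkK, hkJ⟩ := Finset.not_subset.1 hs
        obtain ⟨l', _, hmem', hprod'⟩ := basis_exists_list b.dualBasis K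
        rw [hB, hprod', contr_list_eq_zero V b.dualBasis k _ _ l' ((hmem' k).2 hkK), mul_zero]
        apply interior_list_eq_zero
        intro i hi
        apply h0
        rintro rfl
        exact hkJ ((hmem _).1 (List.mem_reverse.1 hi))
    · intro hJ
      rw [Finsupp.notMem_support_iff.1 hJ, zero_mul]

/-- For a finite-dimensional real vector space `V`, the linear map
`Φ : Λ V ⊗ Λ V* → End(Λ V)`, `Φ(ω ⊗ η) = m(ω) ∘ c(η)`, is a linear isomorphism:
every endomorphism of the exterior algebra is the quantization of a unique symbol. -/
theorem fermionicQuant_bijective [FiniteDimensional ℝ V] :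
    Function.Bijective (fermionicQuant V) := by
  let b := Module.finBasis ℝ V
  have i1 : Module.Finite ℝ (ExteriorAlgebra ℝ V) := Module.Finite.of_basis b.ExteriorAlgebra
  have i2 : Module.Finite ℝ (ExteriorAlgebra ℝ (Module.Dual ℝ V)) :=
    Module.Finite.of_basis b.dualBasis.ExteriorAlgebra
  have hinj := fermionicQuant_injective V b
  refine ⟨hinj, (LinearMap.injective_iff_surjective_of_finrank_eq_finrank ?_).1 hinj⟩
  rw [Module.finrank_tensorProduct, Module.finrank_linearMap,
    Module.finrank_eq_card_basis b.ExteriorAlgebra,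
    Module.finrank_eq_card_basis b.dualBasis.ExteriorAlgebra]

end
end

section
/- Let m ≥ 1, let Q be a real alternating (skew-symmetric) 2m × 2m matrix, and let e₁,…,e_{2m} be the standard basis of ℝ^{2m}. Form the 2-form ω = (1/2) Σ_{i,j} Q_{ij} e_i ∧ e_j ∈ Λ²(ℝ^{2m}). Then the m-th exterior power ω^m is a scalar multiple of the top form: ω^m = m! · c · e₁ ∧ ⋯ ∧ e_{2m} for a unique real number c, and this scalar satisfies c² = det Q. (The number c is the Pfaffian Pf Q; this is the Gaussian Berezin-integral identity ∫Dθ e^{−(1/2)Q^{ab}θ_aθ_b} = Pf Q together with Pf(Q)² = det Q, used in the paper's derivation of the Gauss-Bonnet-Chern formula.) -/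
open ExteriorAlgebra

lemma pf_normal {ι : Type*} [Fintype ι] [DecidableEq ι] (m : ℕ) : ∀ (S : Finset ι) (Q : ι → ι → ℝ),
    S.card ≤ 2 * m → (∀ i j, Q j i = - Q i j) → (∀ i, i ∉ S → ∀ j, Q i j = 0) →
    ∃ f g : Fin m → ι → ℝ, ∀ i j, Q i j = ∑ k, (f k i * g k j - g k i * f k j) := by
  induction m with
  | zero =>
    intro S Q hS hQ hz
    have : S = ∅ := by simpa using hS
    subst this
    exact ⟨0, 0, fun i j => by simpa using hz i (by simp) j⟩
  | succ m ih =>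
    intro S Q hS hQ hz
    by_cases h0 : ∀ i j, Q i j = 0
    · exact ⟨0, 0, fun i j => by simpa using h0 i j⟩
    push Not at h0
    obtain ⟨a, b, hab⟩ := h0
    have haS : a ∈ S := by
      by_contra h
      exact hab (hz a h b)
    have hbS : b ∈ S := by
      by_contra h
      exact hab (by rw [hQ b a, hz b h a, neg_zero])
    have hd : ∀ i, Q i i = 0 := fun i => by linarith [hQ i i]
    have hne : b ≠ a := by
      rintro rfl
      exact hab (hd b)
    have hc : ((S.erase a).erase b).card ≤ 2 * m := by
      rw [Finset.card_erase_of_mem (Finset.mem_erase.2 ⟨hne, hbS⟩), Finset.card_erase_of_mem haS]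
      omega
    obtain ⟨f, g, hfg⟩ := ih ((S.erase a).erase b)
      (fun i j => Q i j - (Q i a * Q j b - Q i b * Q j a) / Q a b) hc
      (fun i j => by rw [hQ i j]; ring)
      (by
        intro i hi j
        simp only [Finset.mem_erase, not_and, ne_eq] at hi
        show Q i j - (Q i a * Q j b - Q i b * Q j a) / Q a b = 0
        by_cases hib : i = b
        · subst hib
          rw [hd, hQ a i, hQ i j]; field_simp; ring
        by_cases hia : i = a
        · subst hia
          rw [hd, hQ i j]; field_simp; ring
        have := hz i (hi hib hia)
        simp [this])
    refine ⟨Fin.cons (fun i => Q i a / Q a b) f, Fin.cons (fun i => Q i b) g, fun i j => ?_⟩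
    rw [Fin.sum_univ_succ]
    simp only [Fin.cons_zero, Fin.cons_succ]
    rw [← hfg]
    ring

lemma pf_pow_add {A : Type*} [Ring A] {a s : A} (h : Commute a s) (ha : a * a = 0) (n : ℕ) :
    (a + s) ^ (n + 1) = s ^ (n + 1) + (n + 1) • (a * s ^ n) := by
  induction n with
  | zero => simp [add_comm]
  | succ n ih =>
    have h1 : a * (a * s ^ n) = 0 := by rw [← mul_assoc, ha, zero_mul]
    have h2 : s * (a * s ^ n) = a * s ^ (n + 1) := by
      rw [← mul_assoc, ← h.eq, mul_assoc, ← pow_succ']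
    rw [pow_succ' _ (n + 1), ih, add_mul, mul_add, mul_add, mul_smul_comm, mul_smul_comm, h1, h2,
      ← pow_succ', smul_zero, add_zero, succ_nsmul _ (n+1)]
    abel

lemma pf_sum_pow {A : Type*} [Ring A] (m : ℕ) : ∀ x : Fin m → A,
    (∀ i j, Commute (x i) (x j)) → (∀ i, x i * x i = 0) →
    (∑ i, x i) ^ m = m.factorial • (List.ofFn x).prod ∧ (∑ i, x i) ^ (m + 1) = 0 := by
  induction m with
  | zero => intro x _ _; simp
  | succ m ih =>
    intro x hc hs
    obtain ⟨h1, h2⟩ := ih (fun i => x i.succ) (fun i j => hc _ _) (fun i => hs _)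
    have hcm : Commute (x 0) (∑ i : Fin m, x i.succ) :=
      Commute.sum_right _ _ _ (fun i _ => hc _ _)
    rw [Fin.sum_univ_succ]
    constructor
    · rw [pf_pow_add hcm (hs 0), h2, h1, zero_add, List.ofFn_succ, List.prod_cons, mul_smul_comm,
        smul_smul, Nat.factorial_succ]
    · rw [pf_pow_add hcm (hs 0), h2, pow_succ _ (m+1), h2]
      simp

def pfE (m : ℕ) : Fin 2 × Fin m ≃ Fin (2 * m) :=
  (Equiv.prodComm _ _).trans (finProdFinEquiv.trans (finCongr (mul_comm _ _)))

lemma pfE_val (m : ℕ) (p : Fin 2 × Fin m) : (pfE m p : ℕ) = p.1 + 2 * p.2 := by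
  simp [pfE]

def pfJ (m : ℕ) : Matrix (Fin (2 * m)) (Fin (2 * m)) ℝ :=
  (Matrix.blockDiagonal (fun _ : Fin m => !![(0 : ℝ), 1; -1, 0])).submatrix (pfE m).symm (pfE m).symm

lemma pfJ_det (m : ℕ) : (pfJ m).det = 1 := by
  simp [pfJ, Matrix.det_blockDiagonal, Matrix.det_fin_two]

noncomputable def pfR (m : ℕ) (f g : Fin m → Fin (2 * m) → ℝ) (p : Fin (2 * m)) : Fin (2 * m) → ℝ :=
  if ((pfE m).symm p).1 = 0 then f ((pfE m).symm p).2 else g ((pfE m).symm p).2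

lemma pfR_det (m : ℕ) (f g : Fin m → Fin (2 * m) → ℝ) (Q : Matrix (Fin (2 * m)) (Fin (2 * m)) ℝ)
    (h : ∀ i j, Q i j = ∑ k, (f k i * g k j - g k i * f k j)) :
    Q.det = (Matrix.of (pfR m f g)).det ^ 2 := by
  have : Q = (Matrix.of (pfR m f g)).transpose * pfJ m * Matrix.of (pfR m f g) := by
    ext i j
    rw [h, Matrix.mul_apply, ← (pfE m).sum_comp]
    simp only [Matrix.mul_apply]
    simp_rw [← (pfE m).sum_comp (fun p => (Matrix.of (pfR m f g)).transpose i p * _)]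
    simp [Fintype.sum_prod_type, pfR, pfJ, Matrix.blockDiagonal_apply, Finset.sum_add_distrib,
      sub_eq_add_neg]
    ring
  rw [this, Matrix.det_mul, Matrix.det_mul, Matrix.det_transpose, pfJ_det]
  ring

lemma pf_prod (m : ℕ) (f g : Fin m → Fin (2 * m) → ℝ) :
    (List.ofFn fun k => ι ℝ (f k) * ι ℝ (g k)).prod = ιMulti ℝ (2 * m) (pfR m f g) := by
  rw [ιMulti_apply, List.ofFn_mul', List.prod_flatten, List.map_ofFn]
  congr 2
  funext k
  have h0 : ∀ h, (⟨2 * (k : ℕ) + 0, h⟩ : Fin (2 * m)) = pfE m (0, k) := fun h => by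
    ext; simp [pfE_val]
  have h1 : ∀ h, (⟨2 * (k : ℕ) + 1, h⟩ : Fin (2 * m)) = pfE m (1, k) := fun h => by
    ext; simp [pfE_val, add_comm]
  simp only [Function.comp, List.ofFn_succ, List.ofFn_zero, List.prod_cons, List.prod_nil, mul_one,
    Fin.val_zero, Fin.val_succ, zero_add, h0, h1]
  simp [pfR]

lemma pf_multi_det (n : ℕ) (v : Fin n → Fin n → ℝ) :
    ιMulti ℝ n v = (Matrix.of v).det • ιMulti ℝ n (fun i : Fin n => (Pi.single i (1 : ℝ) : Fin n → ℝ)) := by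
  set top := ιMulti ℝ n (fun i : Fin n => (Pi.single i (1 : ℝ) : Fin n → ℝ))
  have : ιMulti ℝ n (M := Fin n → ℝ) =
      (LinearMap.toSpanSingleton ℝ _ top).compAlternatingMap
        (Matrix.detRowAlternating (n := Fin n) (R := ℝ)) := by
    refine Module.Basis.ext_alternating (Pi.basisFun ℝ (Fin n)) fun w hw => ?_
    obtain ⟨σ, rfl⟩ : ∃ σ : Equiv.Perm (Fin n), ⇑σ = w :=
      ⟨Equiv.ofBijective w (Finite.injective_iff_bijective.1 hw), rfl⟩
    have := AlternatingMap.map_perm (ιMulti ℝ n (M := Fin n → ℝ))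
      (fun i => Pi.basisFun ℝ (Fin n) i) σ
    have h2 := AlternatingMap.map_perm (Matrix.detRowAlternating (n := Fin n) (R := ℝ))
      (fun i => Pi.basisFun ℝ (Fin n) i) σ
    have h3 : Matrix.detRowAlternating (fun i => Pi.basisFun ℝ (Fin n) i) = (1:ℝ) := by
      have : (fun i => Pi.basisFun ℝ (Fin n) i) = (1 : Matrix (Fin n) (Fin n) ℝ) := by
        ext i j; simp [Matrix.one_apply, Pi.single_apply, eq_comm]
      rw [this]; exact Matrix.det_one
    rw [h3] at h2
    simp only [Function.comp_def] at this h2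
    simp only [LinearMap.compAlternatingMap_apply]
    rw [this, h2]
    rcases Int.units_eq_one_or (Equiv.Perm.sign σ) with hs | hs <;> simp [top, hs]
  rw [this]; rfl

lemma pf_top_ne (n : ℕ) : ιMulti ℝ n (fun i : Fin n => (Pi.single i (1 : ℝ) : Fin n → ℝ)) ≠ 0 := by
  intro h
  have := congrArg (liftAlternating (R := ℝ) (M := Fin n → ℝ) (N := ℝ)
    (fun k => if e : n = k then (Matrix.detRowAlternating (n := Fin n) (R := ℝ)).domDomCongr
      (finCongr e) else 0)) h
  rw [liftAlternating_apply_ιMulti] at this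
  simp at this
  have h2 : (fun i : Fin n => (Pi.single i (1 : ℝ) : Fin n → ℝ)) = (1 : Matrix (Fin n) (Fin n) ℝ) := by
    ext i j; simp [Matrix.one_apply, Pi.single_apply, eq_comm]
  rw [h2] at this
  exact one_ne_zero (Matrix.det_one.symm.trans this)

lemma pf_anti {M : Type*} [AddCommGroup M] [Module ℝ M] (x y : M) : ι ℝ x * ι ℝ y = - (ι ℝ y * ι ℝ x) :=
  eq_neg_of_add_eq_zero_left (ι_add_mul_swap x y)

lemma pf_comm {M : Type*} [AddCommGroup M] [Module ℝ M] (x y z : M) :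
    Commute (ι ℝ x * ι ℝ y) (ι ℝ z) := by
  show _ = _
  rw [mul_assoc, pf_anti y z, mul_neg, ← mul_assoc, pf_anti x z, neg_mul, neg_neg, mul_assoc]

lemma pf_omega (n m : ℕ) (f g : Fin m → Fin n → ℝ) (Q : Matrix (Fin n) (Fin n) ℝ)
    (h : ∀ i j, Q i j = ∑ k, (f k i * g k j - g k i * f k j)) :
    ((1 / 2 : ℝ) • ∑ i : Fin n, ∑ j : Fin n,
            Q i j • (ExteriorAlgebra.ι ℝ (Pi.single i (1 : ℝ)) *
              ExteriorAlgebra.ι ℝ (Pi.single j (1 : ℝ)))) = ∑ k, ι ℝ (f k) * ι ℝ (g k) := by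
  have hι : ∀ v : Fin n → ℝ, ι ℝ v = ∑ i, v i • ι ℝ (Pi.single i (1 : ℝ) : Fin n → ℝ) := by
    intro v
    conv_lhs => rw [pi_eq_sum_univ' v]
    simp [map_sum]
  have hp : ∀ v w : Fin n → ℝ, ι ℝ v * ι ℝ w = ∑ i, ∑ j, (v i * w j) •
      (ι ℝ (Pi.single i (1 : ℝ) : Fin n → ℝ) * ι ℝ (Pi.single j (1 : ℝ) : Fin n → ℝ)) := by
    intro v w
    rw [hι v, hι w, Finset.sum_mul_sum]
    simp_rw [smul_mul_smul_comm]
  have : ∑ i : Fin n, ∑ j : Fin n, Q i j • (ι ℝ (Pi.single i (1 : ℝ) : Fin n → ℝ) *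
      ι ℝ (Pi.single j (1 : ℝ) : Fin n → ℝ)) = ∑ k, (ι ℝ (f k) * ι ℝ (g k) - ι ℝ (g k) * ι ℝ (f k)) := by
    have hk : ∀ k, ι ℝ (f k) * ι ℝ (g k) - ι ℝ (g k) * ι ℝ (f k) =
        ∑ i, ∑ j, (f k i * g k j - g k i * f k j) • (ι ℝ (Pi.single i (1 : ℝ) : Fin n → ℝ) *
          ι ℝ (Pi.single j (1 : ℝ) : Fin n → ℝ)) := by
      intro k
      rw [hp (f k) (g k), hp (g k) (f k)]
      simp only [sub_smul, Finset.sum_sub_distrib]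
    simp only [hk]
    refine Eq.trans ?_ Finset.sum_comm
    refine Finset.sum_congr rfl fun i _ => ?_
    refine Eq.trans ?_ Finset.sum_comm
    refine Finset.sum_congr rfl fun j _ => ?_
    rw [h, Finset.sum_smul]
  rw [this, Finset.smul_sum]
  refine Finset.sum_congr rfl fun k _ => ?_
  rw [pf_anti (g k) (f k), sub_neg_eq_add, ← two_smul ℝ, smul_smul]
  norm_num

theorem pfaffian_exists_unique_and_squares_to_det
    (m : ℕ) (hm : 1 ≤ m) (Q : Matrix (Fin (2 * m)) (Fin (2 * m)) ℝ)
    (hQ : Q.transpose = -Q) :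
    ∃ c : ℝ,
      ((1 / 2 : ℝ) • ∑ i : Fin (2 * m), ∑ j : Fin (2 * m),
            Q i j • (ExteriorAlgebra.ι ℝ (Pi.single i (1 : ℝ)) *
              ExteriorAlgebra.ι ℝ (Pi.single j (1 : ℝ)))) ^ m
          = (m.factorial : ℝ) • c •
              (List.ofFn fun i : Fin (2 * m) =>
                ExteriorAlgebra.ι ℝ (Pi.single i (1 : ℝ))).prod ∧
      (∀ c' : ℝ,
        ((1 / 2 : ℝ) • ∑ i : Fin (2 * m), ∑ j : Fin (2 * m),
              Q i j • (ExteriorAlgebra.ι ℝ (Pi.single i (1 : ℝ)) *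
                ExteriorAlgebra.ι ℝ (Pi.single j (1 : ℝ)))) ^ m
            = (m.factorial : ℝ) • c' •
                (List.ofFn fun i : Fin (2 * m) =>
                  ExteriorAlgebra.ι ℝ (Pi.single i (1 : ℝ))).prod → c' = c) ∧
      c ^ 2 = Q.det := by
  obtain ⟨f, g, h⟩ := pf_normal m Finset.univ (fun i j => Q i j) (by simp)
    (fun i j => by simpa using congrFun (congrFun hQ i) j) (by simp)
  have htop : (List.ofFn fun i : Fin (2 * m) =>
      ExteriorAlgebra.ι ℝ (Pi.single i (1 : ℝ) : Fin (2 * m) → ℝ)).prod =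
      ιMulti ℝ (2 * m) (fun i => (Pi.single i (1 : ℝ) : Fin (2 * m) → ℝ)) := by
    rw [ιMulti_apply]
  have hpow := (pf_sum_pow m (fun k => ι ℝ (f k) * ι ℝ (g k))
    (fun i j => (pf_comm _ _ _).mul_right (pf_comm _ _ _))
    (fun i => by rw [← mul_assoc, (pf_comm _ _ _).eq, ← mul_assoc, ι_sq_zero]; simp)).1
  rw [pf_prod, pf_multi_det, ← pf_omega (2 * m) m f g Q h] at hpow
  rw [htop, hpow]
  refine ⟨(Matrix.of (pfR m f g)).det, by rw [Nat.cast_smul_eq_nsmul], fun c' hc => ?_,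
    (pfR_det m f g Q h).symm⟩
  rw [← Nat.cast_smul_eq_nsmul ℝ] at hc
  have hf : (m.factorial : ℝ) ≠ 0 := by exact_mod_cast m.factorial_ne_zero
  exact (smul_left_injective ℝ (pf_top_ne (2 * m)) (smul_right_injective _ hf hc)).symm
end
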